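/- Suppose a⋆ ∈ 𝒜 and η⋆ ∈ (0,1) satisfy sup_{a∈𝒜} 𝔼_{π₁}[φ(a,·)^{η⋆}] = e^{1/T}. Then for any Markov policy a^∞ with rescaled wealth Z_t = αW_t (started from Z₀ = α) and rejection time τ = inf{t ≥ 1 : Z_t ≥ 1}, the process M_t = e^{-(t∧τ)/T} (Z_{t∧τ})^{η⋆} is a non-negative supermartingale under π₁^⊗ with M₀ = α^{η⋆}; and for the constant policy always playing a⋆, the process N_t = e^{-t/T}(Z_t)^{η⋆} is a non-negative martingale under π₁^⊗. -/

import Mathlib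

open MeasureTheory ProbabilityTheory ENNReal NNReal Set Filter

attribute [local instance] Classical.propDecidable

noncomputable section

variable {𝒳 𝒜 : Type*} [MeasurableSpace 𝒳] [MeasurableSpace 𝒜]

/-- `P` is the law of an i.i.d. sequence of draws from `π`: the infinite product measure
`π^⊗` on the path space `𝒳^∞`, characterized through its finite-dimensional marginals. -/
def IsIIDProduct {𝒳 : Type*} [MeasurableSpace 𝒳] (π : Measure 𝒳)
    (P : Measure (ℕ → 𝒳)) : Prop :=
  IsProbabilityMeasure P ∧
    ∀ n : ℕ, P.map (fun x (i : Fin n) => x i.val) = Measure.pi (fun _ : Fin n => π)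

/-- The natural filtration of the observations on the path space `𝒳^∞`:
`ℱ n` is the σ-algebra generated by the first `n` coordinates. -/
def coordFil (𝒳 : Type*) [MeasurableSpace 𝒳] :
    Filtration ℕ (inferInstance : MeasurableSpace (ℕ → 𝒳)) where
  seq n := ⨆ i ∈ Finset.range n, MeasurableSpace.comap (fun x : ℕ → 𝒳 => x i) inferInstance
  mono' := fun _ _ hnm =>
    biSup_mono fun _ hi => Finset.mem_range.mpr ((Finset.mem_range.mp hi).trans_le hnm)
  le' := fun _ => iSup₂_le fun i _ => (measurable_pi_apply i).comap_le

/-- Wealth process of a Markov policy `a`, where `a n` is the action chosen at round `n+1`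
as a Borel function of the current wealth `w ∈ [0, α⁻¹)`.  Once the wealth leaves
`[0, α⁻¹)` (the rejection threshold has been reached) the process is frozen: the choice of
action is then irrelevant. -/
def mkvWealth (φ : 𝒜 → 𝒳 → ℝ≥0) (α : ℝ≥0)
    (a : (n : ℕ) → (Set.Ico (0 : ℝ≥0) α⁻¹) → 𝒜) : ℕ → (ℕ → 𝒳) → ℝ≥0
  | 0, _ => 1
  | n + 1, x =>
      if h : mkvWealth φ α a n x ∈ Set.Ico (0 : ℝ≥0) α⁻¹ then
        mkvWealth φ α a n x * φ (a n ⟨mkvWealth φ α a n x, h⟩) (x n)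
      else mkvWealth φ α a n x

/-- Rejection time of a Markov policy. -/
def mkvRejTime (φ : 𝒜 → 𝒳 → ℝ≥0) (α : ℝ≥0)
    (a : (n : ℕ) → (Set.Ico (0 : ℝ≥0) α⁻¹) → 𝒜) (x : ℕ → 𝒳) : ℕ∞ :=
  ⨅ (t : ℕ) (_ : 1 ≤ t ∧ α⁻¹ ≤ mkvWealth φ α a t x), (t : ℕ∞)

/-- The stopped time `t ∧ τ` for a Markov policy: it increments as long as the wealth has
not yet reached the threshold `α⁻¹`, and freezes afterwards. -/
def mkvStoppedTime (φ : 𝒜 → 𝒳 → ℝ≥0) (α : ℝ≥0)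
    (a : (n : ℕ) → (Set.Ico (0 : ℝ≥0) α⁻¹) → 𝒜) : ℕ → (ℕ → 𝒳) → ℕ
  | 0, _ => 0
  | n + 1, x => if α⁻¹ ≤ mkvWealth φ α a n x then mkvStoppedTime φ α a n x else n + 1

/-- Wealth of the constant policy that always plays the action `a`. -/
def constWealth (φ : 𝒜 → 𝒳 → ℝ≥0) (a : 𝒜) : ℕ → (ℕ → 𝒳) → ℝ≥0
  | 0, _ => 1
  | n + 1, x => constWealth φ a n x * φ a (x n)

section Independence

theorem IsIIDProduct.eq_infinitePi {𝒳 : Type*} [MeasurableSpace 𝒳] {π : Measure 𝒳}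
    [IsProbabilityMeasure π] {P : Measure (ℕ → 𝒳)} (hP : IsIIDProduct π P) :
    P = Measure.infinitePi (fun _ : ℕ => π) := by
  refine Measure.eq_infinitePi _ fun s t ht => ?_
  obtain ⟨n, hn⟩ := s.exists_nat_subset_range
  set u : ℕ → Set 𝒳 := fun i => if i ∈ s then t i else univ with hu
  have hum : ∀ i, MeasurableSet (u i) := fun i => by
    by_cases hi : i ∈ s <;> simp [hu, hi, ht]
  have hpre : (s : Set ℕ).pi t
      = (fun x (i : Fin n) => x i.val) ⁻¹' (univ.pi fun i : Fin n => u i) := by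
    ext x
    simp only [Set.mem_pi, Finset.mem_coe, mem_preimage, mem_univ, forall_const]
    refine ⟨fun h i => ?_, fun h i hi => ?_⟩
    · by_cases hi : (i : ℕ) ∈ s <;> simp [hu, hi]
      exact h i hi
    · simpa [hu, hi] using h ⟨i, Finset.mem_range.mp (hn hi)⟩
  rw [hpre, ← Measure.map_apply (by fun_prop) (.univ_pi fun i : Fin n => hum i), hP.2 n,
    Measure.pi_pi, Fin.prod_univ_eq_prod_range (fun i => π (u i)) n,
    ← Finset.prod_subset hn fun i _ hi => by simp [hu, hi]]
  exact Finset.prod_congr rfl fun i hi => by simp [hu, hi]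

theorem IsIIDProduct.indep_coordFil {𝒳 : Type*} [MeasurableSpace 𝒳] {π : Measure 𝒳}
    [IsProbabilityMeasure π] {P : Measure (ℕ → 𝒳)} (hP : IsIIDProduct π P) (n : ℕ) :
    Indep (coordFil 𝒳 n) (MeasurableSpace.comap (fun x : ℕ → 𝒳 => x n) inferInstance) P := by
  have hind : iIndepFun (fun (i : ℕ) (x : ℕ → 𝒳) => x i) P := by
    rw [hP.eq_infinitePi]
    exact iIndepFun_infinitePi (X := fun _ x => x) fun _ => measurable_id
  have h := indep_iSup_of_disjoint (fun i => (measurable_pi_apply i).comap_le) hind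
    (S := (Finset.range n : Set ℕ)) (T := {n}) (by simp)
  simpa [coordFil] using h

theorem IsIIDProduct.lintegral_mul_comp_next {𝒳 𝒜 : Type*} [MeasurableSpace 𝒳]
    [MeasurableSpace 𝒜] {π : Measure 𝒳} [IsProbabilityMeasure π] {P : Measure (ℕ → 𝒳)}
    (hP : IsIIDProduct π P) {n : ℕ} {c : (ℕ → 𝒳) → ℝ≥0∞} (hc : Measurable[coordFil 𝒳 n] c)
    {b : (ℕ → 𝒳) → 𝒜} (hb : Measurable[coordFil 𝒳 n] b) {ψ : 𝒜 → 𝒳 → ℝ≥0∞}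
    (hψ : Measurable fun p : 𝒜 × 𝒳 => ψ p.1 p.2) :
    ∫⁻ x, c x * ψ (b x) (x n) ∂P = ∫⁻ x, c x * ∫⁻ y, ψ (b x) y ∂π ∂P := by
  have := hP.1
  have hcb : Measurable[coordFil 𝒳 n] fun x => (c x, b x) := hc.prodMk hb
  have hcb' : Measurable fun x => (c x, b x) := hcb.mono ((coordFil 𝒳).le n) le_rfl
  have hind : IndepFun (fun x => (c x, b x)) (fun x : ℕ → 𝒳 => x n) P :=
    indep_of_indep_of_le_left (hP.indep_coordFil n) hcb.comap_le
  have hlaw : P.map (fun x : ℕ → 𝒳 => x n) = π := by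
    rw [hP.eq_infinitePi]
    exact Measure.infinitePi_map_eval _ n
  have hmap := (indepFun_iff_map_prod_eq_prod_map_map hcb'.aemeasurable
    (measurable_pi_apply n).aemeasurable).mp hind
  rw [hlaw] at hmap
  have hf : Measurable fun p : (ℝ≥0∞ × 𝒜) × 𝒳 => p.1.1 * ψ p.1.2 p.2 := by
    have : Measurable fun p : (ℝ≥0∞ × 𝒜) × 𝒳 => ψ p.1.2 p.2 :=
      hψ.comp (by fun_prop : Measurable fun p : (ℝ≥0∞ × 𝒜) × 𝒳 => (p.1.2, p.2))
    fun_prop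
  calc ∫⁻ x, c x * ψ (b x) (x n) ∂P
      = ∫⁻ p, p.1.1 * ψ p.1.2 p.2 ∂(P.map fun x => ((c x, b x), x n)) :=
        (lintegral_map hf (hcb'.prodMk (measurable_pi_apply n))).symm
    _ = ∫⁻ q, ∫⁻ y, q.1 * ψ q.2 y ∂π ∂(P.map fun x => (c x, b x)) := by
        rw [hmap, lintegral_prod _ hf.aemeasurable]
    _ = ∫⁻ x, ∫⁻ y, c x * ψ (b x) y ∂π ∂P := lintegral_map hf.lintegral_prod_right' hcb'
    _ = _ := lintegral_congr fun x => lintegral_const_mul _ (hψ.of_uncurry_left)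

/-- The one-step growth identity on an event of the past, for an action chosen from the past. -/
theorem IsIIDProduct.setLIntegral_mul_comp_next {𝒳 𝒜 : Type*} [MeasurableSpace 𝒳]
    [MeasurableSpace 𝒜] {π : Measure 𝒳} [IsProbabilityMeasure π] {P : Measure (ℕ → 𝒳)}
    (hP : IsIIDProduct π P) {n : ℕ} {c : (ℕ → 𝒳) → ℝ≥0∞} (hc : Measurable[coordFil 𝒳 n] c)
    {b : (ℕ → 𝒳) → 𝒜} (hb : Measurable[coordFil 𝒳 n] b) {ψ : 𝒜 → 𝒳 → ℝ≥0∞}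
    (hψ : Measurable fun p : 𝒜 × 𝒳 => ψ p.1 p.2) {s : Set (ℕ → 𝒳)}
    (hs : MeasurableSet[coordFil 𝒳 n] s) :
    ∫⁻ x in s, c x * ψ (b x) (x n) ∂P = ∫⁻ x in s, c x * ∫⁻ y, ψ (b x) y ∂π ∂P := by
  have hs' := (coordFil 𝒳).le n s hs
  have h := hP.lintegral_mul_comp_next (hc.indicator hs) hb hψ
  rw [← lintegral_indicator hs', ← lintegral_indicator hs']
  convert h using 2 <;> ext x <;> by_cases hx : x ∈ s <;> simp [hx]

end Independence

section SetLIntegral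

variable {Ω : Type*} {m0 : MeasurableSpace Ω} {μ : Measure Ω}
  {𝒢 : Filtration ℕ m0} {f : ℕ → Ω → ℝ}

theorem integrable_of_setLIntegral_succ_le (hadp : StronglyAdapted 𝒢 f) (hnn : ∀ n x, 0 ≤ f n x)
    (h0 : Integrable (f 0) μ)
    (hle : ∀ n s, MeasurableSet[𝒢 n] s →
      ∫⁻ x in s, ENNReal.ofReal (f (n + 1) x) ∂μ ≤ ∫⁻ x in s, ENNReal.ofReal (f n x) ∂μ) (n : ℕ) :
    Integrable (f n) μ := by
  induction n with
  | zero => exact h0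
  | succ n ih =>
    refine ⟨((hadp (n + 1)).mono (𝒢.le _)).aestronglyMeasurable, ?_⟩
    rw [hasFiniteIntegral_iff_ofReal (ae_of_all _ (hnn _))]
    have h := hle n univ MeasurableSet.univ
    rw [setLIntegral_univ, setLIntegral_univ] at h
    exact h.trans_lt ((hasFiniteIntegral_iff_ofReal (ae_of_all _ (hnn _))).mp ih.2)

theorem setIntegral_eq_toReal_setLIntegral (hadp : StronglyAdapted 𝒢 f) (hnn : ∀ n x, 0 ≤ f n x)
    (n : ℕ) (s : Set Ω) :
    ∫ x in s, f n x ∂μ = (∫⁻ x in s, ENNReal.ofReal (f n x) ∂μ).toReal :=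
  integral_eq_lintegral_of_nonneg_ae (ae_of_all _ (hnn n))
    ((hadp n).mono (𝒢.le _)).aestronglyMeasurable

theorem supermartingale_of_setLIntegral_succ_le [IsFiniteMeasure μ]
    (hadp : StronglyAdapted 𝒢 f) (hnn : ∀ n x, 0 ≤ f n x) (h0 : Integrable (f 0) μ)
    (hle : ∀ n s, MeasurableSet[𝒢 n] s →
      ∫⁻ x in s, ENNReal.ofReal (f (n + 1) x) ∂μ ≤ ∫⁻ x in s, ENNReal.ofReal (f n x) ∂μ) :
    Supermartingale f 𝒢 μ := by
  have hint := integrable_of_setLIntegral_succ_le hadp hnn h0 hle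
  refine supermartingale_of_setIntegral_succ_le hadp hint fun n s hs => ?_
  rw [setIntegral_eq_toReal_setLIntegral hadp hnn, setIntegral_eq_toReal_setLIntegral hadp hnn]
  refine ENNReal.toReal_mono ?_ (hle n s hs)
  exact (((hasFiniteIntegral_iff_ofReal (ae_of_all _ (hnn n))).mp (hint n).integrableOn.2)).ne

theorem martingale_of_setLIntegral_eq_succ [IsFiniteMeasure μ] (hadp : StronglyAdapted 𝒢 f)
    (hnn : ∀ n x, 0 ≤ f n x) (h0 : Integrable (f 0) μ)
    (heq : ∀ n s, MeasurableSet[𝒢 n] s →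
      ∫⁻ x in s, ENNReal.ofReal (f (n + 1) x) ∂μ = ∫⁻ x in s, ENNReal.ofReal (f n x) ∂μ) :
    Martingale f 𝒢 μ := by
  have hint := integrable_of_setLIntegral_succ_le hadp hnn h0 fun n s hs => (heq n s hs).le
  refine martingale_of_setIntegral_eq_succ hadp hint fun n s hs => ?_
  rw [setIntegral_eq_toReal_setLIntegral hadp hnn, setIntegral_eq_toReal_setLIntegral hadp hnn,
    heq n s hs]

end SetLIntegral

section Recursion

variable {𝒳 𝒜 : Type*} {φ : 𝒜 → 𝒳 → ℝ≥0} {α : ℝ≥0}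
  {a : (n : ℕ) → (Set.Ico (0 : ℝ≥0) α⁻¹) → 𝒜}

/-- The action of a Markov policy at round `n + 1`, extended by a default action `d` once the
wealth has reached the threshold. -/
def mkvAction (φ : 𝒜 → 𝒳 → ℝ≥0) (α : ℝ≥0) (a : (n : ℕ) → (Set.Ico (0 : ℝ≥0) α⁻¹) → 𝒜) (d : 𝒜)
    (n : ℕ) (x : ℕ → 𝒳) : 𝒜 :=
  if h : mkvWealth φ α a n x ∈ Set.Ico (0 : ℝ≥0) α⁻¹ then a n ⟨mkvWealth φ α a n x, h⟩ else d

theorem mkvWealth_succ_of_le {n : ℕ} {x : ℕ → 𝒳} (h : α⁻¹ ≤ mkvWealth φ α a n x) :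
    mkvWealth φ α a (n + 1) x = mkvWealth φ α a n x := by
  rw [mkvWealth, dif_neg fun h' => h.not_gt h'.2]

theorem mkvWealth_succ_of_lt (d : 𝒜) {n : ℕ} {x : ℕ → 𝒳} (h : mkvWealth φ α a n x < α⁻¹) :
    mkvWealth φ α a (n + 1) x = mkvWealth φ α a n x * φ (mkvAction φ α a d n x) (x n) := by
  have h' : mkvWealth φ α a n x ∈ Set.Ico (0 : ℝ≥0) α⁻¹ := ⟨zero_le, h⟩
  rw [mkvWealth, mkvAction, dif_pos h', dif_pos h']

theorem mkvStoppedTime_of_lt {n : ℕ} {x : ℕ → 𝒳} (h : mkvWealth φ α a n x < α⁻¹) :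
    mkvStoppedTime φ α a n x = n := by
  cases n with
  | zero => rfl
  | succ n =>
    rw [mkvStoppedTime, if_neg]
    intro h'
    rw [mkvWealth_succ_of_le h'] at h
    exact h'.not_gt h

end Recursion

section Wealth

theorem measurable_coord {n i : ℕ} (hi : i < n) :
    Measurable[coordFil 𝒳 n] fun x : ℕ → 𝒳 => x i :=
  Measurable.of_comap_le
    (le_iSup₂_of_le (f := fun i (_ : i ∈ Finset.range n) =>
      MeasurableSpace.comap (fun x : ℕ → 𝒳 => x i) inferInstance) i (Finset.mem_range.mpr hi) le_rfl)

theorem measurable_constWealth {φ : 𝒜 → 𝒳 → ℝ≥0}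
    (hφ : Measurable fun p : 𝒜 × 𝒳 => φ p.1 p.2) (a : 𝒜) (n : ℕ) :
    Measurable[coordFil 𝒳 n] (constWealth φ a n) := by
  induction n with
  | zero => exact measurable_const
  | succ n ih =>
    exact (ih.mono ((coordFil 𝒳).mono n.le_succ) le_rfl).mul
      ((hφ.of_uncurry_left (x := a)).comp (measurable_coord n.lt_succ_self))

variable {φ : 𝒜 → 𝒳 → ℝ≥0} {α : ℝ≥0} {a : (n : ℕ) → (Set.Ico (0 : ℝ≥0) α⁻¹) → 𝒜}

theorem measurable_mkvAction {n m : ℕ} (ha : Measurable (a n)) (d : 𝒜)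
    (hW : Measurable[coordFil 𝒳 m] (mkvWealth φ α a n)) :
    Measurable[coordFil 𝒳 m] (mkvAction φ α a d n) := by
  have hext : Measurable fun w : ℝ≥0 => if h : w ∈ Set.Ico (0 : ℝ≥0) α⁻¹ then a n ⟨w, h⟩ else d :=
    Measurable.dite ha measurable_const measurableSet_Ico
  exact hext.comp hW

theorem measurable_mkvWealth (hφ : Measurable fun p : 𝒜 × 𝒳 => φ p.1 p.2)
    (ha : ∀ n, Measurable (a n)) (d : 𝒜) (n : ℕ) :
    Measurable[coordFil 𝒳 n] (mkvWealth φ α a n) := by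
  induction n with
  | zero => exact measurable_const
  | succ n ih =>
    have ih' := ih.mono ((coordFil 𝒳).mono n.le_succ) le_rfl
    have hstep : mkvWealth φ α a (n + 1) = fun x => if α⁻¹ ≤ mkvWealth φ α a n x then
        mkvWealth φ α a n x else
        mkvWealth φ α a n x * φ (mkvAction φ α a d n x) (x n) := by
      ext x
      split_ifs with h
      · rw [mkvWealth_succ_of_le h]
      · rw [mkvWealth_succ_of_lt d (not_le.mp h)]
    rw [hstep]
    exact Measurable.ite (measurableSet_le measurable_const ih') ih' (ih'.mul
      (hφ.comp ((measurable_mkvAction (ha n) d ih').prodMk (measurable_coord n.lt_succ_self))))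

theorem measurable_mkvStoppedTime (hφ : Measurable fun p : 𝒜 × 𝒳 => φ p.1 p.2)
    (ha : ∀ n, Measurable (a n)) (d : 𝒜) (n : ℕ) :
    Measurable[coordFil 𝒳 n] (mkvStoppedTime φ α a n) := by
  induction n with
  | zero => exact measurable_const
  | succ n ih =>
    have hmono := (coordFil 𝒳).mono n.le_succ
    exact Measurable.ite (measurableSet_le measurable_const
      ((measurable_mkvWealth hφ ha d n).mono hmono le_rfl)) (ih.mono hmono le_rfl) measurable_const

/-- One round of play multiplies the discounted power of the wealth by a discounted growth
factor. -/
theorem ofReal_discounted_rpow_succ (α W f : ℝ≥0) (T : ℝ) {η : ℝ} (hη : 0 ≤ η) (n : ℕ) :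
    ENNReal.ofReal (Real.exp (-((n + 1 : ℕ) : ℝ) / T) * ((α * (W * f) : ℝ≥0) : ℝ) ^ η)
      = ENNReal.ofReal (Real.exp (-(n : ℝ) / T) * ((α * W : ℝ≥0) : ℝ) ^ η)
        * (ENNReal.ofReal (Real.exp (-(1 / T))) * (f : ℝ≥0∞) ^ η) := by
  have hexp : Real.exp (-((n + 1 : ℕ) : ℝ) / T)
      = Real.exp (-(n : ℝ) / T) * Real.exp (-(1 / T)) := by
    rw [← Real.exp_add]
    congr 1
    push_cast
    ring
  have hf : (f : ℝ≥0∞) ^ η = ENNReal.ofReal ((f : ℝ) ^ η) := by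
    rw [← ENNReal.ofReal_rpow_of_nonneg f.coe_nonneg hη, ENNReal.ofReal_coe_nnreal]
  rw [hf, ← ENNReal.ofReal_mul (by positivity), ← ENNReal.ofReal_mul (by positivity), hexp,
    ← mul_assoc α, NNReal.coe_mul (α * W), Real.mul_rpow (by positivity) (by positivity)]
  congr 1
  ring

theorem ofReal_exp_neg_mul_ofReal_exp (r : ℝ) :
    ENNReal.ofReal (Real.exp (-r)) * ENNReal.ofReal (Real.exp r) = 1 := by
  rw [← ENNReal.ofReal_mul (Real.exp_nonneg _), ← Real.exp_add]
  simp

/-- The discounted growth factor `e^{-1/T} φ(b, y)^η` of the action `b` on the observation `y`. -/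
def discountedGrowth (φ : 𝒜 → 𝒳 → ℝ≥0) (T η : ℝ) (b : 𝒜) (y : 𝒳) : ℝ≥0∞ :=
  ENNReal.ofReal (Real.exp (-(1 / T))) * (φ b y : ℝ≥0∞) ^ η

theorem measurable_discountedGrowth (hφ : Measurable fun p : 𝒜 × 𝒳 => φ p.1 p.2) (T η : ℝ) :
    Measurable fun p : 𝒜 × 𝒳 => discountedGrowth φ T η p.1 p.2 :=
  (hφ.coe_nnreal_ennreal.pow_const η).const_mul _

theorem lintegral_discountedGrowth (hφ : Measurable fun p : 𝒜 × 𝒳 => φ p.1 p.2) (T η : ℝ)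
    (π : Measure 𝒳) (b : 𝒜) :
    ∫⁻ y, discountedGrowth φ T η b y ∂π
      = ENNReal.ofReal (Real.exp (-(1 / T))) * ∫⁻ y, (φ b y : ℝ≥0∞) ^ η ∂π :=
  lintegral_const_mul _ ((hφ.of_uncurry_left (x := b)).coe_nnreal_ennreal.pow_const η)

variable {π : Measure 𝒳} [IsProbabilityMeasure π] {P : Measure (ℕ → 𝒳)} {T η : ℝ}

theorem supermartingale_discounted_mkvWealth (hφ : Measurable fun p : 𝒜 × 𝒳 => φ p.1 p.2)
    (hη : 0 ≤ η) (hgrowth : ∀ b, ∫⁻ y, discountedGrowth φ T η b y ∂π ≤ 1)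
    (hP : IsIIDProduct π P) (ha : ∀ n, Measurable (a n)) (d : 𝒜) :
    Supermartingale
      (fun t x => Real.exp (-(mkvStoppedTime φ α a t x : ℝ) / T)
        * ((α * mkvWealth φ α a t x : ℝ≥0) : ℝ) ^ η) (coordFil 𝒳) P := by
  have := hP.1
  have hM : ∀ t, Measurable[coordFil 𝒳 t] fun x =>
      Real.exp (-(mkvStoppedTime φ α a t x : ℝ) / T)
        * ((α * mkvWealth φ α a t x : ℝ≥0) : ℝ) ^ η := fun t => by
    have hexp : Measurable fun k : ℕ => Real.exp (-(k : ℝ) / T) := measurable_of_countable _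
    have hpow : Measurable fun w : ℝ≥0 => ((α * w : ℝ≥0) : ℝ) ^ η := by fun_prop
    exact (hexp.comp (measurable_mkvStoppedTime hφ ha d t)).mul
      (hpow.comp (measurable_mkvWealth hφ ha d t))
  refine supermartingale_of_setLIntegral_succ_le (fun t => (hM t).stronglyMeasurable)
    (fun t x => by positivity) (by simp [mkvStoppedTime, mkvWealth]) fun n s hs => ?_
  have hW : Measurable[coordFil 𝒳 n] (mkvWealth φ α a n) := measurable_mkvWealth hφ ha d n
  obtain ⟨B, hBdef⟩ : ∃ B : Set (ℕ → 𝒳), B = {x | α⁻¹ ≤ mkvWealth φ α a n x} := ⟨_, rfl⟩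
  have hB : MeasurableSet[coordFil 𝒳 n] B := hBdef ▸ measurableSet_le measurable_const hW
  have hB' := (coordFil 𝒳).le n B hB
  have hs' := (coordFil 𝒳).le n s hs
  rw [← lintegral_inter_add_sdiff _ s hB', ← lintegral_inter_add_sdiff (μ := P) _ s hB']
  refine add_le_add ?_ ?_
  · refine (setLIntegral_congr_fun (hs'.inter hB') fun x hx => ?_).le
    have hle : α⁻¹ ≤ mkvWealth φ α a n x := by simpa [hBdef] using hx.2
    simp only [mkvWealth_succ_of_le hle, mkvStoppedTime, if_pos hle]
  · calc _ = ∫⁻ x in s \ B, ENNReal.ofReal (Real.exp (-(mkvStoppedTime φ α a n x : ℝ) / T)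
            * ((α * mkvWealth φ α a n x : ℝ≥0) : ℝ) ^ η)
            * discountedGrowth φ T η (mkvAction φ α a d n x) (x n) ∂P := by
          refine setLIntegral_congr_fun (hs'.diff hB') fun x hx => ?_
          have hlt : mkvWealth φ α a n x < α⁻¹ := by simpa [hBdef] using hx.2
          simp only [mkvWealth_succ_of_lt d hlt, mkvStoppedTime, if_neg hlt.not_ge,
            mkvStoppedTime_of_lt hlt]
          exact ofReal_discounted_rpow_succ _ _ _ _ hη _
      _ = _ := hP.setLIntegral_mul_comp_next (hM n).ennreal_ofReal
          (measurable_mkvAction (ha n) d hW) (measurable_discountedGrowth hφ T η) (hs.diff hB)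
      _ ≤ _ := lintegral_mono fun x => mul_le_of_le_one_right' (hgrowth _)

theorem martingale_discounted_constWealth (hφ : Measurable fun p : 𝒜 × 𝒳 => φ p.1 p.2)
    (hη : 0 ≤ η) {b : 𝒜} (hgrowth : ∫⁻ y, discountedGrowth φ T η b y ∂π = 1)
    (hP : IsIIDProduct π P) (α : ℝ≥0) :
    Martingale
      (fun (t : ℕ) x => Real.exp (-(t : ℝ) / T)
        * ((α * constWealth φ b t x : ℝ≥0) : ℝ) ^ η) (coordFil 𝒳) P := by
  have := hP.1
  have hN : ∀ t : ℕ, Measurable[coordFil 𝒳 t] fun x =>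
      Real.exp (-(t : ℝ) / T) * ((α * constWealth φ b t x : ℝ≥0) : ℝ) ^ η := fun t => by
    have hG : Measurable fun w : ℝ≥0 =>
      Real.exp (-(t : ℝ) / T) * ((α * w : ℝ≥0) : ℝ) ^ η := by fun_prop
    exact hG.comp (measurable_constWealth hφ b t)
  refine martingale_of_setLIntegral_eq_succ (fun t => (hN t).stronglyMeasurable)
    (fun t x => by positivity) (by simp [constWealth]) fun n s hs => ?_
  have h := hP.setLIntegral_mul_comp_next (b := fun _ => b) (hN n).ennreal_ofReal
    measurable_const (measurable_discountedGrowth hφ T η) hs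
  simp only [hgrowth, mul_one] at h
  rw [← h]
  exact lintegral_congr fun x => ofReal_discounted_rpow_succ _ _ _ _ hη _

end Wealth

theorem edo_supermartingale_martingale
    (𝒳 𝒜 : Type*) [MeasurableSpace 𝒳] [StandardBorelSpace 𝒳]
    [MeasurableSpace 𝒜] [StandardBorelSpace 𝒜]
    (φ : 𝒜 → 𝒳 → ℝ≥0) (hφ : Measurable (fun p : 𝒜 × 𝒳 => φ p.1 p.2))
    (π₁ : Measure 𝒳) [IsProbabilityMeasure π₁]
    (α : ℝ≥0) (hα : 0 < α) (hα1 : α < 1) (T : ℝ) (hT : 0 < T)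
    (astar : 𝒜) (ηstar : ℝ) (hη : ηstar ∈ Set.Ioo (0 : ℝ) 1)
    (hsup : (⨆ b : 𝒜, ∫⁻ x, (φ b x : ℝ≥0∞) ^ ηstar ∂π₁)
      = ENNReal.ofReal (Real.exp (1 / T)))
    (hstar : (∫⁻ x, (φ astar x : ℝ≥0∞) ^ ηstar ∂π₁) = ENNReal.ofReal (Real.exp (1 / T)))
    (P₁ : Measure (ℕ → 𝒳)) (hP₁ : IsIIDProduct π₁ P₁)
    (a : (n : ℕ) → (Set.Ico (0 : ℝ≥0) α⁻¹) → 𝒜) (ha : ∀ n, Measurable (a n)) :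
    -- `M_t = e^{-(t∧τ)/T} (Z_{t∧τ})^{η⋆}` is a non-negative supermartingale with `M₀ = α^{η⋆}`
    Supermartingale
      (fun t x => Real.exp (-(mkvStoppedTime φ α a t x : ℝ) / T)
        * ((α * mkvWealth φ α a t x : ℝ≥0) : ℝ) ^ ηstar)
      (coordFil 𝒳) P₁ ∧
    (∀ x, Real.exp (-(mkvStoppedTime φ α a 0 x : ℝ) / T)
        * ((α * mkvWealth φ α a 0 x : ℝ≥0) : ℝ) ^ ηstar = (α : ℝ) ^ ηstar) ∧
    (∀ t x, 0 ≤ Real.exp (-(mkvStoppedTime φ α a t x : ℝ) / T)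
        * ((α * mkvWealth φ α a t x : ℝ≥0) : ℝ) ^ ηstar) ∧
    -- `N_t = e^{-t/T} Z_t^{η⋆}` is a non-negative martingale for the constant policy `a⋆`
    Martingale
      (fun (t : ℕ) x => Real.exp (-(t : ℝ) / T)
        * ((α * constWealth φ astar t x : ℝ≥0) : ℝ) ^ ηstar)
      (coordFil 𝒳) P₁ ∧
    (∀ (t : ℕ) x, 0 ≤ Real.exp (-(t : ℝ) / T)
        * ((α * constWealth φ astar t x : ℝ≥0) : ℝ) ^ ηstar) := by
  have hgrowth : ∀ b, ∫⁻ y, discountedGrowth φ T ηstar b y ∂π₁ ≤ 1 := fun b => by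
    rw [lintegral_discountedGrowth hφ, ← ofReal_exp_neg_mul_ofReal_exp (1 / T), ← hsup]
    gcongr
    exact le_iSup (fun b => ∫⁻ x, (φ b x : ℝ≥0∞) ^ ηstar ∂π₁) b
  have hgrowth_star : ∫⁻ y, discountedGrowth φ T ηstar astar y ∂π₁ = 1 := by
    rw [lintegral_discountedGrowth hφ, hstar, ofReal_exp_neg_mul_ofReal_exp]
  exact ⟨supermartingale_discounted_mkvWealth hφ hη.1.le hgrowth hP₁ ha astar,
    fun x => by simp [mkvStoppedTime, mkvWealth], fun t x => by positivity,
    martingale_discounted_constWealth hφ hη.1.le hgrowth_star hP₁ α, fun t x => by positivity⟩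

end
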